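/- Let n ≥ 2k > 1. If there exists an antipodal map λ : B^n_k → {±2k, …, ±n} with no k-complementary pair of elements of B^n_k, then there exists an antipodal map λ' : B^n → {1, ±2, …, ±n} with no complementary pair of elements of B^n. (Equivalently, the octahedral Tucker lemma implies the truncated Tucker lemma.) -/

import Mathlib

/-- `leastK k A` is the set `A_{≤k}` of the `k` least elements of `A`
(all of `A` if `|A| ≤ k`; in particular `∅_{≤k} = ∅`). -/
def leastK {n : ℕ} (k : ℕ) (A : Finset (Fin n)) : Finset (Fin n) :=
  ((A.sort (· ≤ ·)).take k).toFinset

/-- The relation `A₁ ≼ A₂` defined by `(A₁ ∪ A₂)_{≤k} = A₂`. -/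
def precRel {n : ℕ} (k : ℕ) (A₁ A₂ : Finset (Fin n)) : Prop :=
  leastK k (A₁ ∪ A₂) = A₂

/-- Membership in the truncated octahedral ball `Bⁿ_k`: `A` and `B` are each a
`k`-element subset of `[n]` or empty, are disjoint, and are not both empty. -/
def memBnk {n : ℕ} (k : ℕ) (A B : Finset (Fin n)) : Prop :=
  (A.card = k ∨ A = ∅) ∧ (B.card = k ∨ B = ∅) ∧ Disjoint A B ∧ ¬(A = ∅ ∧ B = ∅)

/-- The pair order `(A₁,B₁) ≼ (A₂,B₂)`: `A₁ ≼ A₂`, `B₁ ≼ B₂`, and `Aᵢ ∩ Bⱼ = ∅`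
for all `i,j ∈ {1,2}`. -/
def precPair {n : ℕ} (k : ℕ) (A₁ B₁ A₂ B₂ : Finset (Fin n)) : Prop :=
  precRel k A₁ A₂ ∧ precRel k B₁ B₂ ∧
    Disjoint A₁ B₁ ∧ Disjoint A₁ B₂ ∧ Disjoint A₂ B₁ ∧ Disjoint A₂ B₂

theorem mem_take_of_sublist {α : Type*} {l m : List α} (h : l.Sublist m) :
    ∀ (k : ℕ) (x : α), m.Nodup → x ∈ m.take k → x ∈ l → x ∈ l.take k := by
  induction h with
  | slnil => intro k x _ h _; exact h
  | cons a h ih =>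
    intro k x hm hx hl
    rw [List.nodup_cons] at hm
    cases k with
    | zero => simp at hx
    | succ k =>
      rw [List.take_succ_cons, List.mem_cons] at hx
      rcases hx with rfl | hx
      · exact absurd (h.subset hl) hm.1
      · exact (List.take_subset_take_left _ (Nat.le_succ k)) (ih k x hm.2 hx hl)
  | cons_cons a h ih =>
    intro k x hm hx hl
    rw [List.nodup_cons] at hm
    cases k with
    | zero => simp at hx
    | succ k =>
      rw [List.take_succ_cons, List.mem_cons] at hx ⊢
      rcases hx with rfl | hx
      · exact Or.inl rfl
      · rcases List.mem_cons.1 hl with rfl | hl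
        · exact Or.inl rfl
        · exact Or.inr (ih k x hm.2 hx hl)

theorem leastK_subset {n : ℕ} (k : ℕ) (A : Finset (Fin n)) : leastK k A ⊆ A := by
  intro x hx
  simp only [leastK, List.mem_toFinset] at hx
  exact (Finset.mem_sort _).1 (List.mem_of_mem_take hx)

theorem leastK_card {n : ℕ} (k : ℕ) (A : Finset (Fin n)) :
    (leastK k A).card = min k A.card := by
  unfold leastK
  rw [List.toFinset_card_of_nodup]
  · simp
  · exact (Finset.sort_nodup A _).sublist (List.take_sublist _ _)

theorem leastK_between {n : ℕ} (k : ℕ) {A C : Finset (Fin n)} (hA : k ≤ A.card)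
    (h1 : leastK k A ⊆ C) (h2 : C ⊆ A) : leastK k C = leastK k A := by
  symm
  apply Finset.eq_of_subset_of_card_le
  · intro x hx
    have hxC := h1 hx
    simp only [leastK, List.mem_toFinset] at hx ⊢
    refine mem_take_of_sublist ?_ k x (Finset.sort_nodup A _) hx ((Finset.mem_sort _).2 hxC)
    apply List.sublist_of_subperm_of_pairwise (r := (· ≤ ·))
    · apply (Finset.sort_nodup C _).subperm
      intro y hy
      exact (Finset.mem_sort _).2 (h2 ((Finset.mem_sort _).1 hy))
    · exact Finset.pairwise_sort C _
    · exact Finset.pairwise_sort A _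
  · rw [leastK_card, leastK_card]; omega

/-- `A_{≤k}` if `|A| ≥ k`, and the empty set otherwise. -/
def truncK {n : ℕ} (k : ℕ) (A : Finset (Fin n)) : Finset (Fin n) :=
  if k ≤ A.card then leastK k A else ∅

theorem truncK_subset {n : ℕ} (k : ℕ) (A : Finset (Fin n)) : truncK k A ⊆ A := by
  unfold truncK
  split_ifs
  · exact leastK_subset k A
  · simp

theorem truncK_card {n : ℕ} (k : ℕ) (A : Finset (Fin n)) :
    (truncK k A).card = k ∨ truncK k A = ∅ := by
  unfold truncK
  split_ifs with h
  · left; rw [leastK_card]; omega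
  · right; rfl

theorem truncK_ne {n : ℕ} {k : ℕ} (hk : 1 ≤ k) {A : Finset (Fin n)} (h : k ≤ A.card) :
    truncK k A ≠ ∅ := by
  intro h0
  have := leastK_card k A
  rw [truncK, if_pos h] at h0
  rw [h0, Finset.card_empty] at this
  omega

theorem truncK_prec {n : ℕ} (k : ℕ) {A₁ A₂ : Finset (Fin n)} (h : A₁ ⊆ A₂) :
    precRel k (truncK k A₁) (truncK k A₂) := by
  unfold precRel
  by_cases h2 : k ≤ A₂.card
  · have e : truncK k A₂ = leastK k A₂ := if_pos h2
    rw [e]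
    exact leastK_between k h2 Finset.subset_union_right
      (Finset.union_subset ((truncK_subset k A₁).trans h) (leastK_subset k A₂))
  · have h1 : ¬ k ≤ A₁.card := fun hyp => h2 (hyp.trans (Finset.card_le_card h))
    simp [truncK, h1, h2, leastK]

theorem truncK_mem {n : ℕ} {k : ℕ} (hk : 1 ≤ k) {A B : Finset (Fin n)} (hd : Disjoint A B)
    (h : k ≤ A.card ∨ k ≤ B.card) : memBnk k (truncK k A) (truncK k B) := by
  refine ⟨truncK_card k A, truncK_card k B, ?_, ?_⟩
  · exact Finset.disjoint_of_subset_left (truncK_subset k A)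
      (Finset.disjoint_of_subset_right (truncK_subset k B) hd)
  · rintro ⟨h1, h2⟩
    rcases h with h | h
    · exact truncK_ne hk h h1
    · exact truncK_ne hk h h2

open Classical in
/-- The sign of a pair: `1` iff the least element of `A ∪ B` is in `A` (or both are empty). -/
noncomputable def pairSign {n : ℕ} (A B : Finset (Fin n)) : ℤ :=
  if (∃ a ∈ A, ∀ b ∈ B, a < b) ∨ (A = ∅ ∧ B = ∅) then 1 else -1

theorem pairSign_cases {n : ℕ} (A B : Finset (Fin n)) : pairSign A B = 1 ∨ pairSign A B = -1 := by
  unfold pairSign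
  split_ifs <;> simp

theorem pairSign_empty {n : ℕ} : pairSign (∅ : Finset (Fin n)) ∅ = 1 := by
  simp [pairSign]

theorem pairSign_anti {n : ℕ} {A B : Finset (Fin n)} (hd : Disjoint A B)
    (hne : ¬(A = ∅ ∧ B = ∅)) : pairSign A B = - pairSign B A := by
  have key : (∃ a ∈ A, ∀ b ∈ B, a < b) ↔ ¬ (∃ b ∈ B, ∀ a ∈ A, b < a) := by
    constructor
    · rintro ⟨a, ha, hab⟩ ⟨b, hb, hba⟩
      exact lt_asymm (hab b hb) (hba a ha)
    · intro h
      have hU : (A ∪ B).Nonempty := by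
        rw [Finset.nonempty_iff_ne_empty]
        intro h0
        exact hne (Finset.union_eq_empty.1 h0)
      have hmin : ∀ x ∈ A ∪ B, (A ∪ B).min' hU ≤ x := fun x hx => Finset.min'_le _ x hx
      have hmem := Finset.min'_mem _ hU
      generalize (A ∪ B).min' hU = m at hmin hmem
      rw [Finset.disjoint_left] at hd
      rcases Finset.mem_union.1 hmem with hm | hm
      · refine ⟨m, hm, fun b hb => lt_of_le_of_ne (hmin b (Finset.mem_union_right _ hb)) ?_⟩
        rintro rfl
        exact hd hm hb
      · refine absurd ⟨m, hm, fun a ha => lt_of_le_of_ne (hmin a (Finset.mem_union_left _ ha)) ?_⟩ h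
        rintro rfl
        exact hd ha hm
  have hneswap : ¬(B = ∅ ∧ A = ∅) := fun h => hne ⟨h.2, h.1⟩
  unfold pairSign
  by_cases h : ∃ b ∈ B, ∀ a ∈ A, b < a
  · rw [if_neg, if_pos (Or.inl h)]
    rintro (hyp | hyp)
    · exact key.1 hyp h
    · exact hne hyp
  · rw [if_pos (Or.inl (key.2 h)), if_neg]
    · norm_num
    · rintro (hyp | hyp)
      · exact h hyp
      · exact hneswap hyp

/-- Let `n ≥ 2k > 1`. If there is an antipodal map `λ : Bⁿ_k → {±2k, …, ±n}` with no
`k`-complementary pair, then there is an antipodal map `λ' : Bⁿ → {1, ±2, …, ±n}`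
with no complementary pair.  (Thus the octahedral Tucker lemma implies the truncated
Tucker lemma.) -/
theorem truncated_counterexample_lifts (n k : ℕ) (hk : 1 ≤ k) (hn : 2 * k ≤ n)
    (h : ∃ lam : Finset (Fin n) → Finset (Fin n) → ℤ,
      (∀ A B : Finset (Fin n), memBnk k A B →
        2 * k ≤ (lam A B).natAbs ∧ (lam A B).natAbs ≤ n) ∧
      (∀ A B : Finset (Fin n), memBnk k A B → lam A B = - lam B A) ∧
      ¬ ∃ A₁ B₁ A₂ B₂ : Finset (Fin n),
        memBnk k A₁ B₁ ∧ memBnk k A₂ B₂ ∧ precPair k A₁ B₁ A₂ B₂ ∧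
        lam A₁ B₁ = - lam A₂ B₂) :
    ∃ lam' : Finset (Fin n) → Finset (Fin n) → ℤ,
      (∀ A B : Finset (Fin n), Disjoint A B →
        1 ≤ (lam' A B).natAbs ∧ (lam' A B).natAbs ≤ n ∧ lam' A B ≠ -1) ∧
      lam' ∅ ∅ = 1 ∧
      (∀ A B : Finset (Fin n), Disjoint A B → ¬(A = ∅ ∧ B = ∅) →
        lam' A B = - lam' B A) ∧
      ¬ ∃ A₁ B₁ A₂ B₂ : Finset (Fin n),
        Disjoint A₁ B₁ ∧ Disjoint A₂ B₂ ∧ A₁ ⊆ A₂ ∧ B₁ ⊆ B₂ ∧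
        lam' A₁ B₁ = - lam' A₂ B₂ := by
  classical
  obtain ⟨lam, hr, ha, hc⟩ := h
  obtain ⟨L, hL⟩ : ∃ L : Finset (Fin n) → Finset (Fin n) → ℤ, ∀ A B, L A B =
      if k ≤ A.card ∨ k ≤ B.card then lam (truncK k A) (truncK k B)
      else pairSign A B * ((A.card + B.card + 1 : ℕ) : ℤ) := ⟨_, fun _ _ => rfl⟩
  have big : ∀ A B, (k ≤ A.card ∨ k ≤ B.card) → L A B = lam (truncK k A) (truncK k B) :=
    fun A B h => by rw [hL, if_pos h]
  have small : ∀ A B, ¬ (k ≤ A.card ∨ k ≤ B.card) →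
      L A B = pairSign A B * ((A.card + B.card + 1 : ℕ) : ℤ) :=
    fun A B h => by rw [hL, if_neg h]
  have smallAbs : ∀ A B, ¬ (k ≤ A.card ∨ k ≤ B.card) →
      (L A B).natAbs = A.card + B.card + 1 := by
    intro A B h
    rw [small A B h]
    rcases pairSign_cases A B with e | e <;> rw [e] <;> omega
  have bigAbs : ∀ A B, Disjoint A B → (k ≤ A.card ∨ k ≤ B.card) →
      2 * k ≤ (L A B).natAbs ∧ (L A B).natAbs ≤ n := by
    intro A B hd h
    rw [big A B h]
    exact hr _ _ (truncK_mem hk hd h)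
  have h00 : L ∅ ∅ = 1 := by
    rw [small ∅ ∅ (by simp; omega), pairSign_empty]
    simp
  refine ⟨L, ?_, h00, ?_, ?_⟩
  · intro A B hd
    by_cases h : k ≤ A.card ∨ k ≤ B.card
    · have := bigAbs A B hd h
      refine ⟨by omega, by omega, by omega⟩
    · have h1 := smallAbs A B h
      refine ⟨by omega, by omega, ?_⟩
      intro h2
      have hA : A = ∅ := Finset.card_eq_zero.1 (by omega)
      have hB : B = ∅ := Finset.card_eq_zero.1 (by omega)
      rw [hA, hB, h00] at h2
      omega
  · intro A B hd hne
    by_cases h : k ≤ A.card ∨ k ≤ B.card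
    · rw [big A B h, big B A h.symm]
      exact ha _ _ (truncK_mem hk hd h)
    · rw [small A B h, small B A (fun hyp => h hyp.symm), pairSign_anti hd hne,
        Nat.add_comm A.card B.card, neg_mul]
  · rintro ⟨A₁, B₁, A₂, B₂, hd1, hd2, hA, hB, he⟩
    have cA := Finset.card_le_card hA
    have cB := Finset.card_le_card hB
    by_cases h1 : k ≤ A₁.card ∨ k ≤ B₁.card
    · have h2 : k ≤ A₂.card ∨ k ≤ B₂.card := by omega
      rw [big _ _ h1, big _ _ h2] at he
      have dd : ∀ {X Y : Finset (Fin n)}, X ⊆ A₂ → Y ⊆ B₂ → Disjoint X Y := fun hX hY =>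
        Finset.disjoint_of_subset_left hX (Finset.disjoint_of_subset_right hY hd2)
      have tA1 := (truncK_subset k A₁).trans hA
      have tB1 := (truncK_subset k B₁).trans hB
      have tA2 := truncK_subset k A₂
      have tB2 := truncK_subset k B₂
      exact hc ⟨_, _, _, _, truncK_mem hk hd1 h1, truncK_mem hk hd2 h2,
        ⟨truncK_prec k hA, truncK_prec k hB, dd tA1 tB1, dd tA1 tB2, dd tA2 tB1, dd tA2 tB2⟩, he⟩
    · have e1 := smallAbs _ _ h1
      by_cases h2 : k ≤ A₂.card ∨ k ≤ B₂.card
      · have := bigAbs _ _ hd2 h2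
        omega
      · have e2 := smallAbs _ _ h2
        have hA' : A₁ = A₂ := Finset.eq_of_subset_of_card_le hA (by omega)
        have hB' : B₁ = B₂ := Finset.eq_of_subset_of_card_le hB (by omega)
        subst hA' hB'
        omega
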